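/- arXiv:1810.04473 — 3 statements merged into one kernel-verified Lean document; each statement's English description precedes it below -/
import Mathlib

section
/- If T is a tree in 𝒯 and X ⊆ D_T with |X| ≤ 2, then ν(T − X) = ν(T), where T − X is the subgraph of T induced on V(T) \ X. -/
open SimpleGraph

namespace URPaper

/-- `M` is a matching in the simple graph `G`: a finite set of edges of `G`
that are pairwise vertex-disjoint. -/
def IsMatchingSet {V : Type*} (G : SimpleGraph V) (M : Finset (Sym2 V)) : Prop :=
  (∀ e ∈ M, e ∈ G.edgeSet) ∧
    ∀ e ∈ M, ∀ f ∈ M, e ≠ f → ∀ v : V, v ∈ e → v ∉ f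

/-- The set of vertices covered by a set of edges. -/
def covered {V : Type*} (M : Finset (Sym2 V)) : Set V := {v | ∃ e ∈ M, v ∈ e}

/-- A matching `M` in `G` is uniquely restricted if no other matching of `G`
covers exactly the same set of vertices. -/
def IsURMatching {V : Type*} (G : SimpleGraph V) (M : Finset (Sym2 V)) : Prop :=
  IsMatchingSet G M ∧
    ∀ M' : Finset (Sym2 V), IsMatchingSet G M' → covered M' = covered M → M' = M

/-- The matching number `ν(G)`: the maximum size of a matching in `G`. -/
noncomputable def nu {V : Type*} (G : SimpleGraph V) : ℕ :=
  sSup {k | ∃ M : Finset (Sym2 V), IsMatchingSet G M ∧ M.card = k}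

/-- The uniquely restricted matching number `ν_ur(G)`: the maximum size of a
uniquely restricted matching in `G`. -/
noncomputable def nuUR {V : Type*} (G : SimpleGraph V) : ℕ :=
  sSup {k | ∃ M : Finset (Sym2 V), IsURMatching G M ∧ M.card = k}

/-- `D_G`: the set of vertices missed by at least one maximum matching of `G`. -/
def gallaiD {V : Type*} (G : SimpleGraph V) : Set V :=
  {v | ∃ M : Finset (Sym2 V), IsMatchingSet G M ∧ M.card = nu G ∧ v ∉ covered M}

/-- `A_G`: the set of vertices outside `D_G` having a neighbor in `D_G`. -/
def gallaiA {V : Type*} (G : SimpleGraph V) : Set V :=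
  {v | v ∉ gallaiD G ∧ ∃ u ∈ gallaiD G, G.Adj v u}

/-- `C_G = V(G) \ (A_G ∪ D_G)`. -/
def gallaiC {V : Type*} (G : SimpleGraph V) : Set V :=
  {v | v ∉ gallaiD G ∧ v ∉ gallaiA G}

/-- Membership in the family `𝒯`: trees `T` with `ν(T) = (n(T) - 1)/3`
(equivalently `3 ν(T) + 1 = n(T)`) such that every vertex of `A_T` has degree
at most `3` in `T`. -/
def MemT {V : Type*} (T : SimpleGraph V) : Prop :=
  T.IsTree ∧ (∀ v ∈ gallaiA T, (T.neighborSet v).ncard ≤ 3) ∧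
    3 * nu T + 1 = Nat.card V

/-- The graph obtained from `T` by contracting the set `S` to a single new
vertex (the vertex `none`), all other vertices being kept. -/
def contractSet {V : Type*} (T : SimpleGraph V) (S : Set V) :
    SimpleGraph (Option {x : V // x ∉ S}) where
  Adj a b :=
    match a, b with
    | some x, some y => T.Adj x y
    | some x, none => ∃ u ∈ S, T.Adj (x : V) u
    | none, some y => ∃ u ∈ S, T.Adj (y : V) u
    | none, none => False
  symm := by
    refine ⟨?_⟩
    rintro (_ | x) (_ | y) h
    · exact h
    · exact h
    · exact h
    · exact T.adj_symm h
  loopless := by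
    refine ⟨?_⟩
    rintro (_ | x) h
    · exact h
    · exact T.irrefl h

/-- The graph `BG1` from the paper, given by an explicit edge list. -/
def BG1 : SimpleGraph (Fin 10) :=
  SimpleGraph.fromEdgeSet {s(0,4), s(1,4), s(0,5), s(2,5), s(0,6), s(3,6), s(1,7), s(2,7), s(1,8), s(3,8), s(2,9), s(3,9)}

/-- The graph `BG2` from the paper, given by an explicit edge list. -/
def BG2 : SimpleGraph (Fin 13) :=
  SimpleGraph.fromEdgeSet {s(0,4), s(1,4), s(0,5), s(2,5), s(0,6), s(3,6), s(1,7), s(2,7), s(1,8), s(3,8), s(2,9), s(3,9), s(10,6), s(10,7), s(11,8), s(11,5), s(12,4), s(12,9)}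

/-- The graph `BG3` from the paper, given by an explicit edge list. -/
def BG3 : SimpleGraph (Fin 16) :=
  SimpleGraph.fromEdgeSet {s(0,1), s(1,2), s(2,3), s(3,4), s(4,5), s(5,0), s(6,7), s(7,8), s(8,9), s(9,10), s(10,11), s(11,6), s(12,0), s(12,6), s(13,2), s(13,8), s(14,4), s(14,10), s(15,12), s(15,13), s(15,14)}

/-- The graph `BG4` from the paper, given by an explicit edge list. -/
def BG4 : SimpleGraph (Fin 19) :=
  SimpleGraph.fromEdgeSet {s(0,1), s(1,2), s(2,3), s(3,4), s(4,5), s(5,0), s(6,7), s(7,8), s(8,9), s(9,10), s(10,11), s(11,6), s(12,0), s(13,1), s(14,2), s(15,3), s(16,4), s(17,5), s(12,6), s(13,7), s(14,8), s(15,9), s(16,10), s(17,11), s(18,12), s(18,14), s(18,16)}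

/-- The graph `BG5` from the paper, given by an explicit edge list. -/
def BG5 : SimpleGraph (Fin 16) :=
  SimpleGraph.fromEdgeSet {s(0,4), s(1,4), s(0,5), s(2,5), s(0,6), s(3,6), s(1,7), s(2,7), s(1,8), s(3,8), s(2,9), s(3,9), s(10,6), s(10,7), s(11,8), s(11,5), s(12,4), s(12,9), s(13,14), s(14,15), s(13,10), s(13,11), s(15,12)}

/-- The graph `BG6` from the paper, given by an explicit edge list. -/
def BG6 : SimpleGraph (Fin 19) :=
  SimpleGraph.fromEdgeSet {s(0,4), s(1,4), s(0,5), s(2,5), s(0,6), s(3,6), s(1,7), s(2,7), s(1,8), s(3,8), s(2,9), s(3,9), s(10,6), s(10,7), s(11,8), s(11,5), s(12,4), s(12,9), s(13,14), s(14,15), s(15,16), s(16,17), s(17,18), s(18,13), s(13,10), s(15,11), s(17,12)}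

/-- The graph `BG7` from the paper, given by an explicit edge list. -/
def BG7 : SimpleGraph (Fin 19) :=
  SimpleGraph.fromEdgeSet {s(0,1), s(1,2), s(2,3), s(3,4), s(4,5), s(5,0), s(6,7), s(7,8), s(8,9), s(9,10), s(10,11), s(11,6), s(12,0), s(12,6), s(13,2), s(13,8), s(14,4), s(14,10), s(15,12), s(15,13), s(15,14), s(17,16), s(16,18), s(17,9), s(17,5), s(18,3), s(18,11)}

/-- The graph `BG8` from the paper, given by an explicit edge list. -/
def BG8 : SimpleGraph (Fin 22) :=
  SimpleGraph.fromEdgeSet {s(0,1), s(1,2), s(2,3), s(3,4), s(4,5), s(5,0), s(6,7), s(7,8), s(8,9), s(9,10), s(10,11), s(11,6), s(12,0), s(13,1), s(14,2), s(15,3), s(16,4), s(17,5), s(12,6), s(13,7), s(14,8), s(15,9), s(16,10), s(17,11), s(18,12), s(18,14), s(18,16), s(19,20), s(20,21), s(19,13), s(19,15), s(21,17)}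

/-- The graph `BG9` from the paper, given by an explicit edge list. -/
def BG9 : SimpleGraph (Fin 25) :=
  SimpleGraph.fromEdgeSet {s(0,1), s(1,2), s(2,3), s(3,4), s(4,5), s(5,0), s(6,7), s(7,8), s(8,9), s(9,10), s(10,11), s(11,6), s(12,0), s(13,1), s(14,2), s(15,3), s(16,4), s(17,5), s(12,6), s(13,7), s(14,8), s(15,9), s(16,10), s(17,11), s(18,12), s(18,14), s(18,16), s(19,20), s(20,21), s(21,22), s(22,23), s(23,24), s(24,19), s(19,13), s(21,15), s(23,17)}

/-- The graph `GraphH1` from the paper, given by an explicit edge list. -/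
def GraphH1 : SimpleGraph (Fin 14) :=
  SimpleGraph.fromEdgeSet {s(0,4), s(1,4), s(0,5), s(2,5), s(0,6), s(3,6), s(1,7), s(2,7), s(1,8), s(3,8), s(2,9), s(3,9), s(10,6), s(10,7), s(11,8), s(11,5), s(12,4), s(12,9), s(13,10), s(13,11), s(13,12)}

/-- The graph `GraphH2` from the paper, given by an explicit edge list. -/
def GraphH2 : SimpleGraph (Fin 20) :=
  SimpleGraph.fromEdgeSet {s(0,1), s(1,2), s(2,3), s(3,4), s(4,5), s(5,0), s(6,7), s(7,8), s(8,9), s(9,10), s(10,11), s(11,6), s(12,0), s(13,1), s(14,2), s(15,3), s(16,4), s(17,5), s(12,6), s(13,7), s(14,8), s(15,9), s(16,10), s(17,11), s(18,12), s(18,14), s(18,16), s(19,13), s(19,15), s(19,17)}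

/-- Membership in the family `ℬ = {G₁, …, G₉}`, up to isomorphism. -/
def IsBlockB : ∀ (X : Type), SimpleGraph X → Prop := fun _ H =>
  Nonempty (H ≃g BG1) ∨ Nonempty (H ≃g BG2) ∨ Nonempty (H ≃g BG3) ∨
  Nonempty (H ≃g BG4) ∨ Nonempty (H ≃g BG5) ∨ Nonempty (H ≃g BG6) ∨
  Nonempty (H ≃g BG7) ∨ Nonempty (H ≃g BG8) ∨ Nonempty (H ≃g BG9)

/-- Membership in the family `ℬ_c = {G₁, G₂, G₃, G₄}`, up to isomorphism. -/
def IsBlockBc : ∀ (X : Type), SimpleGraph X → Prop := fun _ H =>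
  Nonempty (H ≃g BG1) ∨ Nonempty (H ≃g BG2) ∨ Nonempty (H ≃g BG3) ∨ Nonempty (H ≃g BG4)

/-- `G` (on vertex set `W`) arises from the tree `T` (on vertex set `V`) by
replacing every vertex of `S` by a graph from the family `𝓑`.  The map `π`
sends every vertex of `G` to the vertex of `T` it corresponds to:
* every fiber over a vertex outside `S` is a single vertex, and on these
  vertices `π` is an isomorphism with the corresponding induced subgraph of `T`;
* the fiber over a vertex `s ∈ S` induces a graph of the family `𝓑`;
* there are no edges between the fibers of two distinct vertices of `S`;
* for `s ∈ S` and `v ∉ S`, there is exactly one edge of `G` between the two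
  fibers if `sv ∈ E(T)` and none otherwise;
* each vertex of a fiber over `s ∈ S` has at most one neighbor outside this
  fiber (distinct attachment vertices), and a vertex of such a fiber having a
  neighbor outside the fiber has exactly two neighbors inside it
  (attachment only at vertices of degree `2` of the replacing graph). -/
def ArisesFrom (𝓑 : ∀ (X : Type), SimpleGraph X → Prop) {W V : Type}
    (G : SimpleGraph W) (T : SimpleGraph V) (S : Set V) (π : W → V) : Prop :=
  Function.Surjective π ∧
  (∀ v ∉ S, ∀ w w' : W, π w = v → π w' = v → w = w') ∧
  (∀ w w' : W, π w ∉ S → π w' ∉ S → (G.Adj w w' ↔ T.Adj (π w) (π w'))) ∧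
  (∀ s ∈ S, 𝓑 _ (G.induce (π ⁻¹' {s}))) ∧
  (∀ s ∈ S, ∀ s' ∈ S, s ≠ s' → ∀ w w' : W, π w = s → π w' = s' → ¬ G.Adj w w') ∧
  (∀ s ∈ S, ∀ v ∉ S, T.Adj s v →
    ∃! p : W × W, π p.1 = s ∧ π p.2 = v ∧ G.Adj p.1 p.2) ∧
  (∀ s ∈ S, ∀ v ∉ S, ¬ T.Adj s v →
    ∀ w w' : W, π w = s → π w' = v → ¬ G.Adj w w') ∧
  (∀ s ∈ S, ∀ w : W, π w = s → ∀ w₁ w₂ : W, π w₁ ≠ s → π w₂ ≠ s →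
    G.Adj w w₁ → G.Adj w w₂ → w₁ = w₂) ∧
  (∀ s ∈ S, ∀ w : W, π w = s → ∀ w' : W, π w' ≠ s → G.Adj w w' →
    (G.neighborSet w ∩ π ⁻¹' {s}).ncard = 2)

/-- Membership in the family `𝒢`: graphs arising from a tree `T ∈ 𝒯` by
replacing each vertex of a subset `S ⊆ D_T` by a graph of the family `ℬ`. -/
def InCalG {W : Type} (G : SimpleGraph W) : Prop :=
  ∃ (V : Type) (T : SimpleGraph V) (S : Set V) (π : W → V),
    Finite V ∧ MemT T ∧ S ⊆ gallaiD T ∧ ArisesFrom IsBlockB G T S π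

/-- `κ_G(P)`: the number of connected components of `G` whose induced graph
satisfies the (isomorphism invariant) predicate `P`. -/
noncomputable def kappa {W : Type} (G : SimpleGraph W)
    (P : ∀ (X : Type), SimpleGraph X → Prop) : ℕ :=
  Nat.card {c : G.ConnectedComponent // P _ (G.induce c.supp)}

/-- Membership in `𝒢₃`: cubic graphs of girth at least `5`. -/
def IsCubicGirth5 : ∀ (X : Type), SimpleGraph X → Prop := fun _ H =>
  (∀ v, (H.neighborSet v).ncard = 3) ∧ 5 ≤ H.egirth

/-- Being isomorphic to `H₁` or `H₂`. -/
def IsH1orH2 : ∀ (X : Type), SimpleGraph X → Prop := fun _ H =>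
  Nonempty (H ≃g GraphH1) ∨ Nonempty (H ≃g GraphH2)

/-- `K` is a vertex cover. -/
def IsCov {V : Type*} (G : SimpleGraph V) (K : Finset V) : Prop :=
  ∀ u v, G.Adj u v → u ∈ K ∨ v ∈ K

open Classical in
lemma konig {V : Type*} [Fintype V] (G : SimpleGraph V) (h : G.Colorable 2) :
    ∃ K : Finset V, IsCov G K ∧ ∃ M, IsMatchingSet G M ∧ M.card = K.card := by
  obtain ⟨c⟩ := h
  have hne : (Finset.univ.filter (fun K : Finset V => IsCov G K)).Nonempty :=
    ⟨Finset.univ, Finset.mem_filter.2 ⟨Finset.mem_univ _, fun u _ _ => Or.inl (Finset.mem_univ u)⟩⟩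
  obtain ⟨K, hK, hmin⟩ := Finset.exists_min_image _ Finset.card hne
  simp only [Finset.mem_filter, Finset.mem_univ, true_and] at hK hmin
  refine ⟨K, hK, ?_⟩
  let N : V → Finset V := fun k => Finset.univ.filter (fun v => G.Adj k v ∧ v ∉ K)
  have mono : ∀ s : Finset V, s ⊆ K → (∀ u ∈ s, ∀ v ∈ s, ¬ G.Adj u v) →
      s.card ≤ (s.biUnion N).card := by
    intro s hs hind
    have hc : IsCov G ((K \ s) ∪ s.biUnion N) := by
      have key : ∀ u v, G.Adj u v → u ∈ K →
          u ∈ (K \ s) ∪ s.biUnion N ∨ v ∈ (K \ s) ∪ s.biUnion N := by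
        intro u v huv hu
        by_cases hus : u ∈ s
        · right
          by_cases hv : v ∈ K
          · have : v ∉ s := fun hvs => hind u hus v hvs huv
            simp [hv, this]
          · refine Finset.mem_union_right _ (Finset.mem_biUnion.2 ⟨u, hus, ?_⟩)
            simp [N, huv, hv]
        · left; simp [hu, hus]
      intro u v huv
      rcases hK u v huv with hu | hv
      · exact key u v huv hu
      · exact (key v u huv.symm hv).symm
    have h1 := hmin _ hc
    have h2 := Finset.card_union_le (K \ s) (s.biUnion N)
    have h3 := Finset.card_sdiff_add_card_eq_card hs
    omega
  have hall : ∀ s : Finset K, s.card ≤ (s.biUnion (fun k => N k.1)).card := by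
    intro s
    let s' : Finset V := s.map (Function.Embedding.subtype _)
    have hs' : s' ⊆ K := by
      intro x hx
      simp only [s', Finset.mem_map] at hx
      obtain ⟨y, _, rfl⟩ := hx
      exact y.2
    have e1 : s.biUnion (fun k => N k.1) = s'.biUnion N := by
      ext x; simp [s']
    have e2 : s'.card = s.card := Finset.card_map _
    rw [e1, ← e2]
    have hi : ∀ i : Fin 2, (s'.filter (fun v => c v = i)).card
        ≤ ((s'.filter (fun v => c v = i)).biUnion N).card := by
      intro i
      apply mono
      · exact (Finset.filter_subset _ _).trans hs'
      · intro u hu v hv huv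
        simp only [Finset.mem_filter] at hu hv
        exact c.valid huv (hu.2.trans hv.2.symm)
    have hsum := Finset.card_filter_add_card_filter_not (s := s') (fun v => c v = 0)
    have hneg : s'.filter (fun v => ¬ c v = 0) = s'.filter (fun v => c v = 1) := by
      apply Finset.filter_congr
      intro v _
      have := c v
      generalize c v = z
      fin_cases z <;> simp
    rw [hneg] at hsum
    have hdis : Disjoint ((s'.filter (fun v => c v = 0)).biUnion N)
        ((s'.filter (fun v => c v = 1)).biUnion N) := by
      rw [Finset.disjoint_left]
      intro x hx hy
      simp only [Finset.mem_biUnion, Finset.mem_filter, N, Finset.mem_univ, true_and] at hx hy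
      obtain ⟨a, ⟨_, ha⟩, hax, _⟩ := hx
      obtain ⟨b, ⟨_, hb⟩, hbx, _⟩ := hy
      have h1 := c.valid hax
      have h2 := c.valid hbx
      rw [ha] at h1
      rw [hb] at h2
      revert h1 h2
      generalize c x = z
      fin_cases z <;> simp
    have hsub : ((s'.filter (fun v => c v = 0)).biUnion N) ∪
        ((s'.filter (fun v => c v = 1)).biUnion N) ⊆ s'.biUnion N :=
      Finset.union_subset (Finset.biUnion_subset_biUnion_of_subset_left _ (Finset.filter_subset _ _))
        (Finset.biUnion_subset_biUnion_of_subset_left _ (Finset.filter_subset _ _))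
    have h4 := Finset.card_le_card hsub
    rw [Finset.card_union_of_disjoint hdis] at h4
    have := hi 0
    have := hi 1
    omega
  obtain ⟨f, finj, hf⟩ := (Finset.all_card_le_biUnion_card_iff_exists_injective _).1 hall
  simp only [N, Finset.mem_filter, Finset.mem_univ, true_and] at hf
  have hsame : ∀ (k l : K) (v : V), v ∈ s(k.1, f k) → v ∈ s(l.1, f l) → k = l := by
    intro k l v hk hl
    rw [Sym2.mem_iff] at hk hl
    rcases hk with rfl | rfl
    · rcases hl with h | h
      · exact Subtype.ext h
      · exact absurd (h ▸ k.2) (hf l).2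
    · rcases hl with h | h
      · exact absurd (h ▸ l.2) (hf k).2
      · exact finj h
  refine ⟨Finset.univ.image (fun k : K => s(k.1, f k)), ⟨?_, ?_⟩, ?_⟩
  · intro e he
    simp only [Finset.mem_image, Finset.mem_univ, true_and] at he
    obtain ⟨k, rfl⟩ := he
    exact (hf k).1
  · intro e he e' he' hne v hv hv'
    simp only [Finset.mem_image, Finset.mem_univ, true_and] at he he'
    obtain ⟨k, rfl⟩ := he
    obtain ⟨l, rfl⟩ := he'
    exact hne (by rw [hsame k l v hv hv'])
  · rw [Finset.card_image_of_injective]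
    · simp
    · intro k l hkl
      apply hsame k l k.1 (Sym2.mem_mk_left _ _)
      have hkl' : s(k.1, f k) = s(l.1, f l) := hkl
      rw [← hkl']
      exact Sym2.mem_mk_left _ _

lemma cov_choice {V : Type*} {G : SimpleGraph V} {K : Finset V} {M : Finset (Sym2 V)}
    (hK : IsCov G K) (hM : IsMatchingSet G M) :
    ∃ f : Sym2 V → V, (∀ e ∈ M, f e ∈ e ∧ f e ∈ K) ∧ Set.InjOn f M := by
  have : ∀ e : Sym2 V, ∃ v, e ∈ M → v ∈ e ∧ v ∈ K := by
    intro e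
    by_cases he : e ∈ M
    · induction e using Sym2.ind with
      | _ x y =>
        rcases hK x y (hM.1 _ he) with h | h
        · exact ⟨x, fun _ => ⟨Sym2.mem_mk_left _ _, h⟩⟩
        · exact ⟨y, fun _ => ⟨Sym2.mem_mk_right _ _, h⟩⟩
    · induction e using Sym2.ind with
      | _ x y => exact ⟨x, fun h => absurd h he⟩
  choose f hf using this
  refine ⟨f, hf, ?_⟩
  intro e he e' he' hee
  by_contra hne
  exact hM.2 e he e' he' hne (f e) (hf e he).1 (hee ▸ (hf e' he').1)

lemma card_le_cov {V : Type*} {G : SimpleGraph V} {K : Finset V} {M : Finset (Sym2 V)}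
    (hK : IsCov G K) (hM : IsMatchingSet G M) : M.card ≤ K.card := by
  obtain ⟨f, hf, hi⟩ := cov_choice hK hM
  exact Finset.card_le_card_of_injOn f (fun e he => (hf e he).2) hi

lemma tight {V : Type*} {G : SimpleGraph V} {K : Finset V} {M : Finset (Sym2 V)}
    (hK : IsCov G K) (hM : IsMatchingSet G M) (hc : M.card = K.card) :
    (∀ k ∈ K, k ∈ covered M) ∧ (∀ x y, s(x, y) ∈ M → x ∈ K → y ∉ K) := by
  obtain ⟨f, hf, hi⟩ := cov_choice hK hM
  have hs : ∀ k ∈ K, ∃ e ∈ M, f e = k := by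
    have := Finset.surj_on_of_inj_on_of_card_le (s := M) (t := K) (fun e _ => f e)
      (fun e he => (hf e he).2) (fun e e' he he' h => hi he he' h) hc.ge
    intro k hk
    obtain ⟨e, he, h⟩ := this k hk
    exact ⟨e, he, h.symm⟩
  refine ⟨?_, ?_⟩
  · intro k hk
    obtain ⟨e, he, rfl⟩ := hs k hk
    exact ⟨e, he, (hf e he).1⟩
  · intro x y hxy hx hy
    have aux : ∀ z ∈ K, z ∈ s(x, y) → f s(x, y) = z := by
      intro z hz hzm
      obtain ⟨e, he, h⟩ := hs z hz
      by_cases hee : e = s(x, y)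
      · rw [← hee]; exact h
      · exact absurd hzm (hM.2 e he _ hxy hee z (h ▸ (hf e he).1))
    have h1 := aux x hx (Sym2.mem_mk_left _ _)
    have h2 := aux y hy (Sym2.mem_mk_right _ _)
    have : G.Adj x y := hM.1 _ hxy
    exact this.ne (h1.symm.trans h2)

lemma nu_eq {V : Type*} {G : SimpleGraph V} {K : Finset V} {M : Finset (Sym2 V)}
    (hK : IsCov G K) (hM : IsMatchingSet G M) (hc : M.card = K.card) : nu G = K.card := by
  apply le_antisymm
  · refine csSup_le ⟨M.card, M, hM, rfl⟩ ?_
    rintro k ⟨M', hM', rfl⟩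
    exact card_le_cov hK hM'
  · apply le_csSup
    · exact ⟨K.card, by rintro k ⟨M', hM', rfl⟩; exact card_le_cov hK hM'⟩
    · exact ⟨M, hM, hc⟩

lemma lift_matching {V : Type*} {G : SimpleGraph V} {X : Set V}
    {M : Finset (Sym2 (Xᶜ : Set V))} (hM : IsMatchingSet (G.induce Xᶜ) M) :
    ∃ M' : Finset (Sym2 V), IsMatchingSet G M' ∧ M'.card = M.card ∧ ∀ x ∈ X, x ∉ covered M' := by
  classical
  have hinj : Function.Injective (Sym2.map (Subtype.val : (Xᶜ : Set V) → V)) :=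
    Sym2.map.injective Subtype.val_injective
  refine ⟨M.image (Sym2.map Subtype.val), ⟨?_, ?_⟩, Finset.card_image_of_injective _ hinj, ?_⟩
  · intro e he
    obtain ⟨e, hm, rfl⟩ := Finset.mem_image.1 he
    have := hM.1 e hm
    induction e using Sym2.ind with
    | _ x y => exact this
  · intro e he e' he' hne v hv hv'
    obtain ⟨e, hm, rfl⟩ := Finset.mem_image.1 he
    obtain ⟨e', hm', rfl⟩ := Finset.mem_image.1 he'
    obtain ⟨a, ha, rfl⟩ := Sym2.mem_map.1 hv
    obtain ⟨b, hb, hab⟩ := Sym2.mem_map.1 hv'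
    obtain rfl := Subtype.ext hab
    exact hM.2 e hm e' hm' (fun h => hne (by rw [h])) b ha hb
  · rintro x hx ⟨e, he, hxe⟩
    obtain ⟨e, hm, rfl⟩ := Finset.mem_image.1 he
    obtain ⟨a, ha, rfl⟩ := Sym2.mem_map.1 hxe
    exact a.2 hx

open Classical in
lemma edge_count {V : Type*} [Fintype V] {T : SimpleGraph V} (hT : T.IsTree)
    (B W : Finset V) (hW : W.Nonempty) (hB : ∀ v ∈ B, (T.neighborSet v).ncard ≤ 3)
    (hcov : ∀ u v, T.Adj u v → u ∈ B ∨ v ∈ B ∨ (u ∈ W ∧ v ∈ W)) :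
    Fintype.card V ≤ 3 * B.card + W.card := by
  have hE := hT.card_edgeFinset
  have hne : Nonempty (W : Set V) := hW.to_subtype
  obtain ⟨F, hF, _, hFt⟩ := (connected_top (V := (W : Set V))).exists_isTree_le_of_le_of_isAcyclic
    le_top (hT.isAcyclic.induce (W : Set V))
  have hFe := hFt.card_edgeFinset
  have hWc : Fintype.card (W : Set V) = W.card := by simp
  have hsub : T.edgeFinset ⊆ B.biUnion (fun v => T.incidenceFinset v) ∪
      F.edgeFinset.image (Sym2.map (fun w : (W : Set V) => w.1)) := by
    intro e he
    induction e using Sym2.ind with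
    | _ x y =>
      have hxy : T.Adj x y := by simpa using he
      rw [Finset.mem_union]
      rcases hcov x y hxy with h | h | ⟨h1, h2⟩
      · left; exact Finset.mem_biUnion.2 ⟨x, h, by simp [SimpleGraph.mem_incidenceFinset, mem_incidenceSet, hxy]⟩
      · left; exact Finset.mem_biUnion.2 ⟨y, h, by rw [Sym2.eq_swap]; simp [SimpleGraph.mem_incidenceFinset, mem_incidenceSet, hxy.symm]⟩
      · right
        refine Finset.mem_image.2 ⟨s(⟨x, h1⟩, ⟨y, h2⟩), ?_, rfl⟩
        rw [mem_edgeFinset]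
        exact hF hxy
  have h1 := Finset.card_le_card hsub
  have h2 := Finset.card_union_le (B.biUnion (fun v => T.incidenceFinset v))
    (F.edgeFinset.image (Sym2.map (fun w : (W : Set V) => w.1)))
  have h3 : (B.biUnion (fun v => T.incidenceFinset v)).card ≤ B.card * 3 := by
    apply Finset.card_biUnion_le_card_mul
    intro v hv
    rw [card_incidenceFinset_eq_degree]
    have := hB v hv
    rwa [Set.ncard_eq_toFinset_card', ← SimpleGraph.neighborFinset_def, card_neighborFinset_eq_degree] at this
  have h4 := Finset.card_image_le (s := F.edgeFinset) (f := Sym2.map (fun w : (W : Set V) => w.1))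
  omega

/-- Lemma 4 (i) of the paper. If `T ∈ 𝒯` and `X ⊆ D_T` with
`|X| ≤ 2`, then `ν(T - X) = ν(T)`. -/
theorem statement7 {V : Type} [Fintype V] (T : SimpleGraph V) (hT : MemT T)
    (X : Set V) (hXD : X ⊆ gallaiD T) (hcard : X.ncard ≤ 2) :
    nu (T.induce Xᶜ) = nu T := by
  classical
  obtain ⟨htree, hdeg, hn⟩ := hT
  obtain ⟨K, hK, M, hM, hMK⟩ := konig T htree.colorable_two
  have hnu := nu_eq hK hM hMK
  -- minimum covers avoid D
  have hKD : ∀ K' : Finset V, IsCov T K' → K'.card = nu T → ∀ v ∈ K', v ∉ gallaiD T := by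
    rintro K' hK' hc v hv ⟨N, hN, hNc, hvN⟩
    exact hvN ((tight hK' hN (hNc.trans hc.symm)).1 v hv)
  have hAK : ∀ K' : Finset V, IsCov T K' → K'.card = nu T → ∀ v ∈ gallaiA T, v ∈ K' := by
    rintro K' hK' hc v ⟨_, u, hu, hvu⟩
    rcases hK' v u hvu with h | h
    · exact h
    · exact absurd hu (hKD K' hK' hc u h)
  -- lifting covers of induced subgraphs
  have hlift : ∀ Y : Set V, ∃ K' : Finset V, K'.card = nu (T.induce Yᶜ) ∧
      (∀ u v, T.Adj u v → u ∉ Y → v ∉ Y → u ∈ K' ∨ v ∈ K') ∧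
      ∃ M' : Finset (Sym2 V), IsMatchingSet T M' ∧ M'.card = K'.card ∧
        ∀ x ∈ Y, x ∉ covered M' := by
    intro Y
    obtain ⟨K', hK', M', hM', hc⟩ := konig (T.induce Yᶜ) (htree.isAcyclic.induce _).colorable_two
    obtain ⟨M'', h1, h2, h3⟩ := lift_matching hM'
    refine ⟨K'.map (Function.Embedding.subtype _), ?_, ?_, M'', h1, ?_, h3⟩
    · rw [Finset.card_map, nu_eq hK' hM' hc]
    · intro u v huv hu hv
      rcases hK' ⟨u, hu⟩ ⟨v, hv⟩ huv with h | h
      · left; exact Finset.mem_map.2 ⟨_, h, rfl⟩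
      · right; exact Finset.mem_map.2 ⟨_, h, rfl⟩
    · rw [h2, hc, Finset.card_map]
  -- vertices outside D lie in some minimum cover
  have hin : ∀ x, x ∉ gallaiD T → ∃ K' : Finset V, IsCov T K' ∧ K'.card = nu T ∧ x ∈ K' := by
    intro x hx
    obtain ⟨K', _, hcov, M', hM', hc, hmiss⟩ := hlift {x}
    have hcov' : IsCov T (insert x K') := by
      intro u v huv
      by_cases hu : u = x
      · left; simp [hu]
      by_cases hv : v = x
      · right; simp [hv]
      rcases hcov u v huv hu hv with h | h
      · left; simp [h]
      · right; simp [h]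
    have h1 : M'.card ≤ K.card := card_le_cov hK hM'
    have h2 : M'.card ≠ nu T := fun h => hx ⟨M', hM', h, hmiss x rfl⟩
    have h3 := Finset.card_insert_le x K'
    have h4 := card_le_cov hcov' hM
    exact ⟨_, hcov', by omega, Finset.mem_insert_self _ _⟩
  let A : Finset V := Finset.univ.filter (fun v => v ∈ gallaiA T)
  let C : Finset V := Finset.univ.filter (fun v => v ∈ gallaiC T)
  have hA : ∀ v, v ∈ A ↔ v ∈ gallaiA T := by intro v; simp [A]
  have hC : ∀ v, v ∈ C ↔ v ∉ gallaiD T ∧ v ∉ gallaiA T := by intro v; simp only [C, Finset.mem_filter, Finset.mem_univ, true_and]; exact Iff.rfl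
  have hAK' : A ⊆ K := fun v hv => hAK K hK hnu.symm v ((hA v).1 hv)
  have hKAC : K \ A = K ∩ C := by
    ext v
    simp only [Finset.mem_sdiff, Finset.mem_inter, hA, hC]
    constructor
    · rintro ⟨h1, h2⟩; exact ⟨h1, hKD K hK hnu.symm v h1, h2⟩
    · rintro ⟨h1, h2⟩; exact ⟨h1, h2.2⟩
  have hKcard : (K ∩ C).card + A.card = K.card := by
    rw [← hKAC]; exact Finset.card_sdiff_add_card_eq_card hAK'
  have hCK : (C \ K).card ≤ (K ∩ C).card := by
    have hp : ∀ x ∈ C \ K, ∃ y, s(x, y) ∈ M ∧ y ∈ K ∩ C := by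
      intro x hx
      obtain ⟨hxC, hxK⟩ := Finset.mem_sdiff.1 hx
      have hxD := ((hC x).1 hxC).1
      have hxcov : x ∈ covered M := by
        by_contra h
        exact hxD ⟨M, hM, hMK.trans hnu.symm, h⟩
      obtain ⟨e, he, hxe⟩ := hxcov
      obtain ⟨y, rfl⟩ := hxe
      have hyK : y ∈ K := (hK x y (hM.1 _ he)).resolve_left hxK
      refine ⟨y, he, Finset.mem_inter.2 ⟨hyK, (hC y).2 ⟨hKD K hK hnu.symm y hyK, ?_⟩⟩⟩
      intro hyA
      obtain ⟨K', hK', hc', hxK'⟩ := hin x hxD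
      exact (tight hK' hM (by omega)).2 x y he hxK' (hAK K' hK' hc' y hyA)
    choose! g hg using hp
    apply Finset.card_le_card_of_injOn g (fun x hx => (hg x hx).2)
    intro x hx x' hx' hxx
    have h1 := (hg x hx).1
    have h2 := (hg x' hx').1
    rw [← hxx] at h2
    by_contra hne
    have hne' : s(x, g x) ≠ s(x', g x) := by
      intro h
      exact hne (Sym2.congr_left.1 h)
    exact hM.2 _ h1 _ h2 hne' (g x) (Sym2.mem_mk_right _ _) (Sym2.mem_mk_right _ _)
  have hCcard : C.card ≤ 2 * (K ∩ C).card := by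
    have := Finset.card_sdiff_add_card_inter C K
    rw [Finset.inter_comm C K] at this
    omega
  rw [Nat.card_eq_fintype_card] at hn
  -- every edge meets A or lies within C
  have hedge : ∀ u v, T.Adj u v → u ∈ A ∨ v ∈ A ∨ (u ∈ C ∧ v ∈ C) := by
    intro u v huv
    by_cases hu : u ∈ gallaiD T
    · by_cases hv : v ∈ gallaiD T
      · rcases hK u v huv with h | h
        · exact absurd hu (hKD K hK hnu.symm u h)
        · exact absurd hv (hKD K hK hnu.symm v h)
      · right; left; exact (hA v).2 ⟨hv, u, hu, huv.symm⟩
    · by_cases hv : v ∈ gallaiD T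
      · left; exact (hA u).2 ⟨hu, v, hv, huv⟩
      · by_cases h1 : u ∈ gallaiA T
        · left; exact (hA u).2 h1
        by_cases h2 : v ∈ gallaiA T
        · right; left; exact (hA v).2 h2
        · right; right; exact ⟨(hC u).2 ⟨hu, h1⟩, (hC v).2 ⟨hv, h2⟩⟩
  have hCempty : C = ∅ := by
    by_contra hne
    have := edge_count htree A C (Finset.nonempty_iff_ne_empty.2 hne)
      (fun v hv => hdeg v ((hA v).1 hv)) hedge
    omega
  have hAcard : A.card = nu T := by
    rw [hCempty] at hKcard
    simp at hKcard
    omega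
  have hedge' : ∀ u v, T.Adj u v → u ∈ A ∨ v ∈ A := by
    intro u v huv
    rcases hedge u v huv with h | h | h
    · exact Or.inl h
    · exact Or.inr h
    · rw [hCempty] at h; simp at h
  -- final step
  obtain ⟨K', hK'c, hcov, M', hM', hc, hmiss⟩ := hlift X
  rw [← hK'c]
  have hle : K'.card ≤ nu T := by
    rw [← hc, hnu]; exact card_le_cov hK hM'
  refine le_antisymm hle ?_
  rw [← hAcard]
  let S := A \ K'
  have hXf : X.toFinset.card ≤ 2 := by rwa [Set.ncard_eq_toFinset_card'] at hcard
  rcases S.eq_empty_or_nonempty with hS | hS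
  · exact Finset.card_le_card (Finset.sdiff_eq_empty_iff_subset.1 hS)
  let Q : Finset V := (K' \ A) ∪ X.toFinset
  have hcnt := edge_count htree (A ∩ K') (S ∪ Q) (hS.mono Finset.subset_union_left)
    (fun v hv => hdeg v ((hA v).1 (Finset.mem_inter.1 hv).1)) (by
      have key : ∀ u v, T.Adj u v → u ∈ A →
          u ∈ A ∩ K' ∨ v ∈ A ∩ K' ∨ (u ∈ S ∪ Q ∧ v ∈ S ∪ Q) := by
        intro u v huv hu
        by_cases huK : u ∈ K'
        · left; exact Finset.mem_inter.2 ⟨hu, huK⟩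
        have huS : u ∈ S := Finset.mem_sdiff.2 ⟨hu, huK⟩
        by_cases hvX : v ∈ X
        · right; right
          exact ⟨Finset.mem_union_left _ huS, by simp [Q, hvX]⟩
        have huX : u ∉ X := fun h => ((hA u).1 hu).1 (hXD h)
        have hvK : v ∈ K' := (hcov u v huv huX hvX).resolve_left huK
        by_cases hvA : v ∈ A
        · right; left; exact Finset.mem_inter.2 ⟨hvA, hvK⟩
        · right; right
          exact ⟨Finset.mem_union_left _ huS, by simp [Q, hvK, hvA]⟩
      intro u v huv
      rcases hedge' u v huv with h | h
      · exact key u v huv h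
      · rcases key v u huv.symm h with h | h | h
        · exact Or.inr (Or.inl h)
        · exact Or.inl h
        · exact Or.inr (Or.inr ⟨h.2, h.1⟩))
  have h1 := Finset.card_union_le S Q
  have h2 : Q.card ≤ (K' \ A).card + X.toFinset.card := Finset.card_union_le _ _
  have h3 : S.card + (A ∩ K').card = A.card := Finset.card_sdiff_add_card_inter A K'
  have h4 := Finset.card_sdiff_add_card_inter K' A
  rw [Finset.inter_comm K' A] at h4
  have h5 := hS.card_pos
  omega

end URPaper
end

section
/- For every tree T, the set D_T is an independent set of T; equivalently, every component of the subgraph of T induced on D_T is a single vertex. -/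
open SimpleGraph

namespace URPaper

theorem card_le_nu {V : Type} [Fintype V] {G : SimpleGraph V} {M : Finset (Sym2 V)}
    (hM : IsMatchingSet G M) : M.card ≤ nu G := by
  classical
  refine le_csSup ⟨Fintype.card (Sym2 V), ?_⟩ ⟨M, hM, rfl⟩
  rintro k ⟨N, _, rfl⟩
  exact Finset.card_le_univ N


theorem mix {V : Type} {G : SimpleGraph V} {M N : Finset (Sym2 V)} (A : Set V)
    [DecidableEq (Sym2 V)] (P Q : Sym2 V → Prop) [DecidablePred P] [DecidablePred Q]
    (hM : IsMatchingSet G M) (hN : IsMatchingSet G N)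
    (hP : ∀ e ∈ M, P e → ∀ x ∈ e, x ∈ A) (hQ : ∀ e ∈ N, Q e → ∀ x ∈ e, x ∉ A) :
    IsMatchingSet G (M.filter P ∪ N.filter Q) ∧
    (M.filter P ∪ N.filter Q).card = (M.filter P).card + (N.filter Q).card := by
  constructor
  · refine ⟨?_, ?_⟩
    · intro e he
      simp only [Finset.mem_union, Finset.mem_filter] at he
      rcases he with he | he
      · exact hM.1 e he.1
      · exact hN.1 e he.1
    · intro e he f hf hef x hx hxf
      simp only [Finset.mem_union, Finset.mem_filter] at he hf
      rcases he with he | he <;> rcases hf with hf | hf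
      · exact hM.2 e he.1 f hf.1 hef x hx hxf
      · exact hQ f hf.1 hf.2 x hxf (hP e he.1 he.2 x hx)
      · exact hQ e he.1 he.2 x hx (hP f hf.1 hf.2 x hxf)
      · exact hN.2 e he.1 f hf.1 hef x hx hxf
  · apply Finset.card_union_of_disjoint
    rw [Finset.disjoint_left]
    intro e he hf
    simp only [Finset.mem_filter] at he hf
    induction e using Sym2.ind with
    | _ x y =>
      exact hQ _ hf.1 hf.2 x (Sym2.mem_mk_left x y) (hP _ he.1 he.2 x (Sym2.mem_mk_left x y))

/-- For every tree `T`, the set `D_T` is an independent set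
of `T`. -/
theorem statement12 {V : Type} [Fintype V] (T : SimpleGraph V) (hT : T.IsTree) :
    ∀ u ∈ gallaiD T, ∀ v ∈ gallaiD T, ¬ T.Adj u v := by
  classical
  rintro u ⟨M, hM, hMc, hMu⟩ v ⟨N, hN, hNc, hNv⟩ huv
  have hb : T.IsBridge s(u, v) := (isAcyclic_iff_forall_adj_isBridge.1 hT.isAcyclic) huv
  set H := T.deleteEdges {s(u, v)} with hH
  set A : Set V := {x | H.Reachable u x} with hA
  have huA : u ∈ A := Reachable.refl _
  have hvA : v ∉ A := by
    have := isBridge_iff.1 hb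
    simpa [hA, hH] using this
  have key : ∀ e ∈ T.edgeSet, e ≠ s(u, v) → ∀ x ∈ e, ∀ y ∈ e, x ∈ A → y ∈ A := by
    intro e he hne x hx y hy hxA
    by_cases hxy : x = y
    · exact hxy ▸ hxA
    have h2 : e = s(x, y) := (Sym2.mem_and_mem_iff hxy).1 ⟨hx, hy⟩
    subst h2
    have : H.Adj x y := by
      rw [hH, deleteEdges_adj]
      exact ⟨he, hne⟩
    exact Reachable.trans hxA this.reachable
  have hMe : ∀ e ∈ M, e ≠ s(u, v) := by
    rintro e he rfl
    exact hMu ⟨_, he, Sym2.mem_mk_left u v⟩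
  have hNe : ∀ e ∈ N, e ≠ s(u, v) := by
    rintro e he rfl
    exact hNv ⟨_, he, Sym2.mem_mk_right u v⟩
  let P : Sym2 V → Prop := fun e => ∀ x ∈ e, x ∈ A
  have nP : ∀ K : Finset (Sym2 V), IsMatchingSet T K → (∀ e ∈ K, e ≠ s(u, v)) →
      ∀ e ∈ K, ¬ P e → ∀ x ∈ e, x ∉ A := by
    intro K hK hKe e he hnP x hx hxA
    exact hnP fun y hy => key e (hK.1 e he) (hKe e he) x hx y hy hxA
  obtain ⟨h1, c1⟩ := mix A P (fun e => ¬ P e) hM hN (fun e _ h => h) (nP N hN hNe)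
  obtain ⟨h2, c2⟩ := mix A P (fun e => ¬ P e) hN hM (fun e _ h => h) (nP M hM hMe)
  have b2 := card_le_nu h2
  set K := M.filter P ∪ N.filter (fun e => ¬ P e) with hK
  have hKu : ∀ f ∈ K, u ∉ f := by
    intro f hf hu
    simp only [hK, Finset.mem_union, Finset.mem_filter] at hf
    rcases hf with hf | hf
    · exact hMu ⟨f, hf.1, hu⟩
    · exact nP N hN hNe f hf.1 hf.2 u hu huA
  have hKv : ∀ f ∈ K, v ∉ f := by
    intro f hf hv
    simp only [hK, Finset.mem_union, Finset.mem_filter] at hf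
    rcases hf with hf | hf
    · exact hvA (hf.2 v hv)
    · exact hNv ⟨f, hf.1, hv⟩
  have h3 : IsMatchingSet T (insert s(u, v) K) := by
    have aux : ∀ f ∈ K, ∀ x ∈ s(u, v), x ∉ f := by
      intro f hf x hx
      rcases Sym2.mem_iff.1 hx with rfl | rfl
      · exact hKu f hf
      · exact hKv f hf
    refine ⟨?_, ?_⟩
    · intro e he
      rcases Finset.mem_insert.1 he with rfl | he
      · exact huv
      · exact h1.1 e he
    · intro e he f hf hef x hx hxf
      rcases Finset.mem_insert.1 he with rfl | he <;>
        rcases Finset.mem_insert.1 hf with rfl | hf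
      · exact hef rfl
      · exact aux f hf x hx hxf
      · exact aux e he x hxf hx
      · exact h1.2 e he f hf hef x hx hxf
  have hnot : s(u, v) ∉ K := fun h => hKu _ h (Sym2.mem_mk_left u v)
  have b1 := card_le_nu h3
  rw [Finset.card_insert_of_notMem hnot, c1] at b1
  rw [c2] at b2
  have e1 := Finset.card_filter_add_card_filter_not (s := M) P
  have e2 := Finset.card_filter_add_card_filter_not (s := N) P
  omega

end URPaper
end

section
/- If M is a matching in a graph G such that every edge of M is a bridge of G (i.e., lies on no cycle of G), then M is a uniquely restricted matching in G. -/
open SimpleGraph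

namespace URPaper

open Classical in
lemma card_cov {V : Type} (G : SimpleGraph V) (N : Finset (Sym2 V)) (hN : IsMatchingSet G N)
    (C : V → Prop) :
    ((N.biUnion Sym2.toFinset).filter C).card = ∑ f ∈ N, (f.toFinset.filter C).card := by
  rw [Finset.filter_biUnion, Finset.card_biUnion]
  intro e he f hf hef
  rw [Function.onFun, Finset.disjoint_left]
  intro v hv hv'
  simp only [Finset.mem_filter, Sym2.mem_toFinset] at hv hv'
  exact hN.2 e he f hf hef v hv.1 hv'.1

open Classical in
lemma even_edge {V : Type} (G : SimpleGraph V) (e f : Sym2 V) (u : V) (hf : f ∈ G.edgeSet)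
    (hef : f ≠ e) :
    Even ((f.toFinset.filter (fun x => (G.deleteEdges {e}).Reachable u x)).card) := by
  induction f with
  | h a b =>
    have hab : G.Adj a b := hf
    have h : (G.deleteEdges {e}).Adj a b := by
      rw [SimpleGraph.deleteEdges_adj]
      exact ⟨hab, by simpa using hef⟩
    have hiff : (G.deleteEdges {e}).Reachable u a ↔ (G.deleteEdges {e}).Reachable u b :=
      ⟨fun k => k.trans h.reachable, fun k => k.trans h.symm.reachable⟩
    rw [Sym2.toFinset_mk_eq]
    by_cases k : (G.deleteEdges {e}).Reachable u b
    · simp [Finset.filter_insert, Finset.filter_singleton, hiff, k, hab.ne]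
    · simp [Finset.filter_insert, Finset.filter_singleton, hiff, k]

open Classical in
lemma sub_of {V : Type} (G : SimpleGraph V) (M : Finset (Sym2 V))
    (hM : IsMatchingSet G M)
    (hbridge : ∀ e ∈ M, ∀ (v : V) (c : G.Walk v v), c.IsCycle → e ∉ c.edges)
    (M' : Finset (Sym2 V)) (hM' : IsMatchingSet G M') (hc : covered M' = covered M) :
    M ⊆ M' := by
  intro e he
  by_contra he'
  have hb : G.IsBridge e :=
    (SimpleGraph.isBridge_iff_forall_cycle_notMem (hM.1 e he)).2 (fun u p => hbridge e he u p)
  have hS : M'.biUnion Sym2.toFinset = M.biUnion Sym2.toFinset := by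
    ext v
    have : v ∈ covered M' ↔ v ∈ covered M := by rw [hc]
    simpa [covered] using this
  induction e with
  | h u v =>
    have huv : G.Adj u v := hM.1 _ he
    have h1 := card_cov G M hM (fun x => (G.deleteEdges {s(u, v)}).Reachable u x)
    have h2 := card_cov G M' hM' (fun x => (G.deleteEdges {s(u, v)}).Reachable u x)
    rw [hS, h1] at h2
    rw [← Finset.add_sum_erase _ _ he] at h2
    have e2 : Even (∑ f ∈ M', (f.toFinset.filter
        (fun x => (G.deleteEdges {s(u, v)}).Reachable u x)).card) :=
      Finset.even_sum _ (fun f hf => even_edge G _ f u (hM'.1 f hf) (by rintro rfl; exact he' hf))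
    have e1 : Even (∑ f ∈ M.erase s(u, v), (f.toFinset.filter
        (fun x => (G.deleteEdges {s(u, v)}).Reachable u x)).card) :=
      Finset.even_sum _ (fun f hf => even_edge G _ f u (hM.1 f (Finset.mem_of_mem_erase hf))
        (Finset.ne_of_mem_erase hf))
    have e3 : ((s(u, v)).toFinset.filter
        (fun x => (G.deleteEdges {s(u, v)}).Reachable u x)).card = 1 := by
      have := SimpleGraph.isBridge_iff.1 hb
      rw [Sym2.toFinset_mk_eq, Finset.filter_insert, Finset.filter_singleton, if_neg this,
        if_pos (SimpleGraph.Reachable.refl u)]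
      simp
    rw [e3] at h2
    rw [← h2] at e2
    grind

/-- If `M` is a matching in a graph `G` such that every edge
of `M` is a bridge of `G` (i.e. lies on no cycle of `G`), then `M` is a
uniquely restricted matching in `G`. -/
theorem statement13 {V : Type} (G : SimpleGraph V) (M : Finset (Sym2 V))
    (hM : IsMatchingSet G M)
    (hbridge : ∀ e ∈ M, ∀ (v : V) (c : G.Walk v v), c.IsCycle → e ∉ c.edges) :
    IsURMatching G M := by
  refine ⟨hM, fun M' hM' hc => ?_⟩
  have hsub := sub_of G M hM hbridge M' hM' hc
  refine Finset.Subset.antisymm (fun f hf => ?_) hsub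
  obtain ⟨v, hv⟩ : ∃ v, v ∈ f := by
    induction f with
    | h a b => exact ⟨a, Sym2.mem_mk_left a b⟩
  have hcv : v ∈ covered M' := ⟨f, hf, hv⟩
  rw [hc] at hcv
  obtain ⟨e, he, hve⟩ := hcv
  by_cases h : e = f
  · exact h ▸ he
  · exact absurd hv (hM'.2 e (hsub he) f hf h v hve)

end URPaper
end
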